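/- Let σ > 0, set b* = (σ+1)^{1+1/σ}/σ and g(x) = x^{−1/σ} + b*·x. Then for every irrational x ∈ (0,1), B_σ(x) ≥ g(x); consequently B_σ(x) ≥ b* for every irrational x ∈ (0,1) (the infimum of g over (0,1] equals b*, attained at x = (b*σ)^{−σ/(σ+1)}). -/

import Mathlib

open Real Set MeasureTheory
open scoped ENNReal

/-- The Gauss map `A(x) = 1/x - ⌊1/x⌋`. -/
noncomputable def gaussMap (x : ℝ) : ℝ := 1 / x - (⌊1 / x⌋ : ℝ)

/-- `brjunoBeta x j = β_{j-1}(x) = ∏_{i=0}^{j-1} A^i(x)`; in particular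
`brjunoBeta x 0 = β_{-1}(x) = 1` and `β_K(x) = brjunoBeta x (K+1)`. -/
noncomputable def brjunoBeta (x : ℝ) (j : ℕ) : ℝ := ∏ i ∈ Finset.range j, gaussMap^[i] x

/-- The σ-Brjuno function `B_σ(x) = Σ_{j≥0} β_{j-1}(x) · (A^j x)^{-1/σ}`, valued in `[0,+∞]`. -/
noncomputable def brjuno (σ x : ℝ) : ℝ≥0∞ :=
  ∑' j : ℕ, ENNReal.ofReal (brjunoBeta x j * (gaussMap^[j] x) ^ (-(1 / σ)))

/-- The K-th partial sum `B_σ^{(K)}(x) = Σ_{j=0}^{K} β_{j-1}(x) · (A^j x)^{-1/σ}`. -/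
noncomputable def brjunoPartial (σ x : ℝ) (K : ℕ) : ℝ :=
  ∑ j ∈ Finset.range (K + 1), brjunoBeta x j * (gaussMap^[j] x) ^ (-(1 / σ))

/-- The fixed point `η_m = (√(m²+4) − m)/2 = [0; m, m, m, ...]` of the Gauss map. -/
noncomputable def eta (m : ℕ) : ℝ := (Real.sqrt ((m : ℝ) ^ 2 + 4) - m) / 2

/-- `b* = (σ+1)^{1+1/σ}/σ`. -/
noncomputable def bstar (σ : ℝ) : ℝ := (σ + 1) ^ (1 + 1 / σ) / σ

/-- The global lower bound `g(x) = x^{-1/σ} + b*·x`. -/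
noncomputable def gLow (σ x : ℝ) : ℝ := x ^ (-(1 / σ)) + bstar σ * x

/-- The cylinder lower bound `g_k(x) = x^{-1/σ} + x·(1/x − k)^{-1/σ} + (1 − kx)·b*`. -/
noncomputable def gCyl (σ : ℝ) (k : ℕ) (x : ℝ) : ℝ :=
  x ^ (-(1 / σ)) + x * (1 / x - (k : ℝ)) ^ (-(1 / σ)) + (1 - (k : ℝ) * x) * bstar σ

/-- The weighted AM-GM inequality behind the minimality of `b*`. -/
lemma bstar_mul_one_sub_le {σ x : ℝ} (hσ : 0 < σ) (hx : x ∈ Set.Ioo (0 : ℝ) 1) :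
    bstar σ * (1 - x) ≤ x ^ (-(1 / σ)) := by
  obtain ⟨h0, h1⟩ := hx
  have hs : 0 < σ + 1 := by linarith
  have hy : 0 < 1 - x := by linarith
  have hp : 0 ≤ (σ + 1) * x := by positivity
  have hq : 0 ≤ (σ + 1) * (1 - x) / σ := by positivity
  have hamgm := Real.geom_mean_le_arith_mean2_weighted (w₁ := 1 / (σ + 1)) (w₂ := σ / (σ + 1))
    (by positivity) (by positivity) hp hq (by field_simp; ring)
  have hmean : 1 / (σ + 1) * ((σ + 1) * x) + σ / (σ + 1) * ((σ + 1) * (1 - x) / σ) = 1 := by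
    field_simp; ring
  rw [hmean] at hamgm
  have hpow := Real.rpow_le_rpow (z := (σ + 1) / σ) (by positivity) hamgm (by positivity)
  rw [Real.one_rpow, Real.mul_rpow (by positivity) (by positivity), ← Real.rpow_mul hp,
    ← Real.rpow_mul hq, show 1 / (σ + 1) * ((σ + 1) / σ) = 1 / σ by field_simp,
    show σ / (σ + 1) * ((σ + 1) / σ) = 1 by field_simp, Real.rpow_one,
    Real.mul_rpow hs.le h0.le] at hpow
  rw [Real.rpow_neg h0.le, ← one_div, le_div_iff₀ (by positivity), bstar, Real.rpow_add hs,
    Real.rpow_one]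
  exact le_of_eq_of_le (by ring) hpow

lemma gaussMap_eq_fract (x : ℝ) : gaussMap x = Int.fract (1 / x) := rfl

lemma irrational_gaussMap {x : ℝ} (hx : Irrational x) : Irrational (gaussMap x) := by
  rw [gaussMap, one_div]
  exact hx.inv.sub_intCast _

lemma gaussMap_mem_Ioo {x : ℝ} (hx : Irrational x) : gaussMap x ∈ Set.Ioo (0 : ℝ) 1 := by
  have hne := (irrational_gaussMap hx).ne_zero
  rw [gaussMap_eq_fract] at hne ⊢
  exact ⟨(Int.fract_nonneg _).lt_of_ne' hne, Int.fract_lt_one _⟩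

lemma irrational_iterate_gaussMap {x : ℝ} (hx : Irrational x) (j : ℕ) :
    Irrational (gaussMap^[j] x) := by
  induction j with
  | zero => exact hx
  | succ j ih => rw [Function.iterate_succ_apply']; exact irrational_gaussMap ih

lemma iterate_gaussMap_mem_Ioo {x : ℝ} (hx : Irrational x) (hx01 : x ∈ Set.Ioo (0 : ℝ) 1)
    (j : ℕ) : gaussMap^[j] x ∈ Set.Ioo (0 : ℝ) 1 := by
  cases j with
  | zero => exact hx01
  | succ j =>
    rw [Function.iterate_succ_apply']
    exact gaussMap_mem_Ioo (irrational_iterate_gaussMap hx j)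

lemma mul_gaussMap_le_half {x : ℝ} (hx : x ∈ Set.Ioo (0 : ℝ) 1) : x * gaussMap x ≤ 1 / 2 := by
  obtain ⟨h0, h1⟩ := hx
  have hfloor : (1 : ℝ) ≤ (⌊1 / x⌋ : ℝ) := by
    exact_mod_cast Int.le_floor.2 (by push_cast; exact (one_lt_one_div h0 h1).le)
  have hlt : gaussMap x < 1 := Int.fract_lt_one _
  have heq : x * gaussMap x + x * (⌊1 / x⌋ : ℝ) = 1 := by
    rw [gaussMap]; field_simp; ring
  nlinarith

lemma brjunoBeta_succ (x : ℝ) (j : ℕ) :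
    brjunoBeta x (j + 1) = brjunoBeta x j * gaussMap^[j] x :=
  Finset.prod_range_succ _ _

lemma brjunoBeta_pos {x : ℝ} (hx : Irrational x) (hx01 : x ∈ Set.Ioo (0 : ℝ) 1) (j : ℕ) :
    0 < brjunoBeta x j :=
  Finset.prod_pos fun i _ => (iterate_gaussMap_mem_Ioo hx hx01 i).1

lemma brjunoBeta_two_mul_le {x : ℝ} (hx : Irrational x) (hx01 : x ∈ Set.Ioo (0 : ℝ) 1) (n : ℕ) :
    brjunoBeta x (2 * n) ≤ (1 / 2) ^ n := by
  induction n with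
  | zero => simp [brjunoBeta]
  | succ n ih =>
    rw [Nat.mul_succ, brjunoBeta_succ, brjunoBeta_succ, Function.iterate_succ_apply', mul_assoc,
      pow_succ]
    have hmem := iterate_gaussMap_mem_Ioo hx hx01 (2 * n)
    have hnonneg := (gaussMap_mem_Ioo (irrational_iterate_gaussMap hx (2 * n))).1.le
    exact mul_le_mul ih (mul_gaussMap_le_half hmem) (mul_nonneg hmem.1.le hnonneg) (by positivity)

lemma gLow_sub_le_brjunoPartial {σ x : ℝ} (hσ : 0 < σ) (hx : Irrational x)
    (hx01 : x ∈ Set.Ioo (0 : ℝ) 1) (K : ℕ) :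
    gLow σ x - bstar σ * brjunoBeta x (K + 1) ≤ brjunoPartial σ x K := by
  induction K with
  | zero => simp [gLow, brjunoPartial, brjunoBeta]
  | succ K ih =>
    rw [brjunoPartial, Finset.sum_range_succ, ← brjunoPartial, brjunoBeta_succ x (K + 1)]
    have hstep := mul_le_mul_of_nonneg_left
      (bstar_mul_one_sub_le hσ (iterate_gaussMap_mem_Ioo hx hx01 (K + 1)))
      (brjunoBeta_pos hx hx01 (K + 1)).le
    linarith

lemma ofReal_brjunoPartial_le_brjuno (σ : ℝ) {x : ℝ} (hx : Irrational x)
    (hx01 : x ∈ Set.Ioo (0 : ℝ) 1) (K : ℕ) :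
    ENNReal.ofReal (brjunoPartial σ x K) ≤ brjuno σ x := by
  rw [brjunoPartial, ENNReal.ofReal_sum_of_nonneg fun j _ => mul_nonneg
    (brjunoBeta_pos hx hx01 j).le (Real.rpow_nonneg (iterate_gaussMap_mem_Ioo hx hx01 j).1.le _)]
  exact ENNReal.sum_le_tsum _

lemma bstar_pos {σ : ℝ} (hσ : 0 < σ) : 0 < bstar σ := by
  unfold bstar; positivity

lemma ofReal_gLow_le_brjuno {σ x : ℝ} (hσ : 0 < σ) (hx : Irrational x)
    (hx01 : x ∈ Set.Ioo (0 : ℝ) 1) : ENNReal.ofReal (gLow σ x) ≤ brjuno σ x := by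
  have hlim : Filter.Tendsto
      (fun n : ℕ => ENNReal.ofReal (gLow σ x - bstar σ * (1 / 2 : ℝ) ^ (n + 1)))
      Filter.atTop (nhds (ENNReal.ofReal (gLow σ x))) := by
    refine ENNReal.tendsto_ofReal ?_
    have hpow := (tendsto_pow_atTop_nhds_zero_of_lt_one (r := (1 / 2 : ℝ))
      (by norm_num) (by norm_num)).comp (Filter.tendsto_add_atTop_nat 1)
    simpa using (hpow.const_mul (bstar σ)).const_sub (gLow σ x)
  refine le_of_tendsto' hlim fun n => ?_
  refine (ENNReal.ofReal_le_ofReal ?_).trans (ofReal_brjunoPartial_le_brjuno σ hx hx01 (2 * n + 1))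
  refine le_trans ?_ (gLow_sub_le_brjunoPartial hσ hx hx01 (2 * n + 1))
  exact sub_le_sub_left
    (mul_le_mul_of_nonneg_left (brjunoBeta_two_mul_le hx hx01 (n + 1)) (bstar_pos hσ).le) _

/-- the global lower bound `B_σ(x) ≥ g(x) = x^{−1/σ} + b*·x`, and in
particular `B_σ(x) ≥ b* = (σ+1)^{1+1/σ}/σ`, for all irrational `x ∈ (0,1)`. -/
theorem brjuno_global_lower_bound (σ : ℝ) (hσ : 0 < σ) (x : ℝ) (hx : Irrational x)
    (hx01 : x ∈ Set.Ioo (0 : ℝ) 1) :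
    ENNReal.ofReal (gLow σ x) ≤ brjuno σ x ∧ ENNReal.ofReal (bstar σ) ≤ brjuno σ x := by
  refine ⟨ofReal_gLow_le_brjuno hσ hx hx01,
    (ENNReal.ofReal_le_ofReal ?_).trans (ofReal_gLow_le_brjuno hσ hx hx01)⟩
  have hmin := bstar_mul_one_sub_le hσ hx01
  rw [gLow]
  linarith
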